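/- arXiv:2109.07610 — 4 statements merged into one kernel-verified Lean document; each statement's English description precedes it below -/
import Mathlib

section
/- Assume the Goldberg–Seymour statement: every multigraph H with χ'(H) ≥ Δ(H)+2 satisfies χ'(H) = ⌈ρ(H)⌉. Then every multigraph G satisfying χ'(G) ≥ max{Δ(G)+2, |V(G)|+1} has total chromatic number equal to its chromatic index, i.e. χ''(G) = χ'(G). -/
/-- A multigraph: a finite graph possibly with parallel edges but no loops.
Edges are abstract objects, each mapped to an unordered pair of distinct vertices. -/
structure Multigraph where
  V : Type
  E : Type
  fintypeV : Fintype V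
  fintypeE : Fintype E
  decEqV : DecidableEq V
  decEqE : DecidableEq E
  ends : E → Sym2 V
  loopless : ∀ e, ¬ (ends e).IsDiag

attribute [instance] Multigraph.fintypeV Multigraph.fintypeE
attribute [instance] Multigraph.decEqV Multigraph.decEqE

namespace Multigraph

variable (G : Multigraph)

/-- The degree of a vertex: the number of edges incident with it. -/
def degree (v : G.V) : ℕ :=
  (Finset.univ.filter fun e : G.E => v ∈ G.ends e).card

/-- The maximum degree Δ(G). -/
def maxDegree : ℕ :=
  Finset.univ.sup G.degree

/-- A proper edge coloring with color set `Fin k`: edges sharing an endpoint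
receive distinct colors. -/
def IsProperEdgeColoring {k : ℕ} (φ : G.E → Fin k) : Prop :=
  ∀ e f : G.E, e ≠ f → (∃ v, v ∈ G.ends e ∧ v ∈ G.ends f) → φ e ≠ φ f

/-- The chromatic index χ'(G): the least `k` admitting a proper edge `k`-coloring. -/
noncomputable def chromaticIndex : ℕ :=
  sInf {k | ∃ φ : G.E → Fin k, G.IsProperEdgeColoring φ}

/-- Two vertices are adjacent if some edge joins them. -/
def Adj (u v : G.V) : Prop := ∃ e, G.ends e = s(u, v)

/-- A proper total coloring with color set `Fin k`: no two adjacent or incident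
elements of `V(G) ∪ E(G)` receive the same color. -/
def IsProperTotalColoring {k : ℕ} (cV : G.V → Fin k) (cE : G.E → Fin k) : Prop :=
  G.IsProperEdgeColoring cE ∧
  (∀ u v : G.V, G.Adj u v → cV u ≠ cV v) ∧
  (∀ v e, v ∈ G.ends e → cV v ≠ cE e)

/-- The total chromatic number χ''(G): the least `k` admitting a proper total
`k`-coloring. -/
noncomputable def totalChromaticNumber : ℕ :=
  sInf {k | ∃ (cV : G.V → Fin k) (cE : G.E → Fin k), G.IsProperTotalColoring cV cE}

/-- `H` is a subgraph of `G`: there are injections of the vertices and edges of `H`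
into those of `G` preserving the incidence structure. -/
def IsSubgraph (H G : Multigraph) : Prop :=
  ∃ (f : H.V → G.V) (g : H.E → G.E),
    Function.Injective f ∧ Function.Injective g ∧
    ∀ e, G.ends (g e) = (H.ends e).map f

/-- `H` is a spanning subgraph of `G`: a subgraph whose vertex set is all of `V(G)`. -/
def IsSpanningSubgraph (H G : Multigraph) : Prop :=
  ∃ (f : H.V → G.V) (g : H.E → G.E),
    Function.Bijective f ∧ Function.Injective g ∧
    ∀ e, G.ends (g e) = (H.ends e).map f

/-- `H` is a proper subgraph of `G`. -/
def IsProperSubgraph (H G : Multigraph) : Prop :=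
  IsSubgraph H G ∧ ¬ IsSubgraph G H

/-- `G` is edge-chromatic critical: every proper subgraph has a smaller chromatic index. -/
def EdgeChromaticCritical (G : Multigraph) : Prop :=
  ∀ H : Multigraph, IsProperSubgraph H G → H.chromaticIndex < G.chromaticIndex

/-- The density ρ(G) = max{2|E(H)|/(|V(H)|−1) : H ⊆ G, |V(H)| ≥ 3 odd}
(0 if no such subgraph exists). -/
noncomputable def density (G : Multigraph) : ℝ :=
  sSup ({0} ∪ {q : ℝ | ∃ H : Multigraph, IsSubgraph H G ∧ Odd (Fintype.card H.V) ∧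
    3 ≤ Fintype.card H.V ∧
    q = 2 * (Fintype.card H.E : ℝ) / ((Fintype.card H.V : ℝ) - 1)})

/-- A subgraph of `G` given by a set of vertices and a set of edges of `G`
whose endpoints all lie in the chosen vertex set. -/
structure Sub (G : Multigraph) where
  verts : Finset G.V
  edges : Finset G.E
  support : ∀ e ∈ edges, ∀ v, v ∈ G.ends e → v ∈ verts

/-- A subgraph is `k`-dense if its order is odd and at least 3, and
`2|E(H)| = k(|V(H)|−1)`. -/
def Sub.IsDense {G : Multigraph} (S : G.Sub) (k : ℕ) : Prop :=
  Odd S.verts.card ∧ 3 ≤ S.verts.card ∧ 2 * S.edges.card = k * (S.verts.card - 1)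

/-- A subgraph is maximal `k`-dense if it is `k`-dense and no `k`-dense subgraph
contains it as a proper subgraph. -/
def Sub.MaximalDense {G : Multigraph} (S : G.Sub) (k : ℕ) : Prop :=
  S.IsDense k ∧ ∀ T : G.Sub, T.IsDense k → S.verts ⊆ T.verts → S.edges ⊆ T.edges →
    S.verts = T.verts ∧ S.edges = T.edges

/-- The set of colors of `Fin k` missing at `v` under the edge coloring `φ`. -/
def missing {k : ℕ} (φ : G.E → Fin k) (v : G.V) : Set (Fin k) :=
  {c | ∀ e : G.E, v ∈ G.ends e → φ e ≠ c}

/-- A vertex set `W` is elementary under `φ` if the sets of missing colors of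
distinct vertices of `W` are disjoint. -/
def Elementary {k : ℕ} (φ : G.E → Fin k) (W : Set G.V) : Prop :=
  ∀ u ∈ W, ∀ v ∈ W, u ≠ v → Disjoint (G.missing φ u) (G.missing φ v)

/-- An edge is a boundary edge of `W` if exactly one of its ends lies in `W`. -/
def IsBoundaryEdge (W : Set G.V) (e : G.E) : Prop :=
  ∃ a b, G.ends e = s(a, b) ∧ a ∈ W ∧ b ∉ W

/-- Deleting an edge from a multigraph. -/
def deleteEdge (G : Multigraph) (e : G.E) : Multigraph where
  V := G.V
  E := {f : G.E // f ≠ e}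
  fintypeV := G.fintypeV
  fintypeE := by classical exact inferInstance
  decEqV := G.decEqV
  decEqE := by classical exact inferInstance
  ends := fun f => G.ends f.1
  loopless := fun f => G.loopless f.1

/-- Adding a new edge joining two distinct vertices of a multigraph. -/
def addEdge (G : Multigraph) (u v : G.V) (huv : u ≠ v) : Multigraph where
  V := G.V
  E := Option G.E
  fintypeV := G.fintypeV
  fintypeE := inferInstance
  decEqV := G.decEqV
  decEqE := inferInstance
  ends := fun e => e.elim s(u, v) G.ends
  loopless := fun e => by
    cases e with
    | none => simpa using huv
    | some f => exact G.loopless f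

end Multigraph

open Multigraph

namespace Multigraph

/-- Adding a new vertex `none` joined by a single edge to every vertex of a multigraph. -/
def cone (G : Multigraph) : Multigraph where
  V := Option G.V
  E := G.E ⊕ G.V
  fintypeV := inferInstance
  fintypeE := inferInstance
  decEqV := inferInstance
  decEqE := inferInstance
  ends := Sum.elim (fun e => (G.ends e).map some) (fun v => s(none, some v))
  loopless := by
    rintro (e | v)
    · have h := G.loopless e
      revert h
      simp only [Sum.elim_inl]
      induction G.ends e with
      | h a b => simp
    · simp

/-- The new vertex of the cone. -/
def apex (G : Multigraph) : G.cone.V := (none : Option G.V)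

/-- The inclusion of the vertices of a multigraph into its cone. -/
def base (G : Multigraph) (v : G.V) : G.cone.V := some v

lemma base_injective (G : Multigraph) : Function.Injective G.base := Option.some_injective G.V

lemma base_ne_apex (G : Multigraph) (v : G.V) : G.base v ≠ G.apex := Option.some_ne_none v

lemma exists_base_eq_of_ne_apex {G : Multigraph} {x : G.cone.V} (hx : x ≠ G.apex) :
    ∃ v, x = G.base v := Option.ne_none_iff_exists'.1 hx

lemma cone_ends_inl (G : Multigraph) (e : G.E) :
    G.cone.ends (Sum.inl e) = (G.ends e).map G.base := rfl

lemma cone_ends_inr (G : Multigraph) (v : G.V) :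
    G.cone.ends (Sum.inr v) = s(G.apex, G.base v) := rfl

lemma base_mem_cone_ends_inl {G : Multigraph} {e : G.E} {v : G.V} :
    G.base v ∈ G.cone.ends (Sum.inl e) ↔ v ∈ G.ends e := by
  simp [cone_ends_inl, Sym2.mem_map, G.base_injective.eq_iff]

lemma base_mem_cone_ends_inr {G : Multigraph} {v w : G.V} :
    G.base v ∈ G.cone.ends (Sum.inr w) ↔ v = w := by
  simp [cone_ends_inr, G.base_ne_apex, G.base_injective.eq_iff]

lemma apex_notMem_cone_ends_inl {G : Multigraph} {e : G.E} :
    G.apex ∉ G.cone.ends (Sum.inl e) := by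
  simp [cone_ends_inl, Sym2.mem_map, G.base_ne_apex]

lemma degree_le_card_of_forall_mem {G : Multigraph} {v : G.V} (s : Finset G.E)
    (hs : ∀ e, v ∈ G.ends e → e ∈ s) : G.degree v ≤ s.card :=
  Finset.card_le_card fun e he => hs e (Finset.mem_filter.1 he).2

lemma degree_cone_base (G : Multigraph) (v : G.V) :
    G.cone.degree (G.base v) ≤ G.degree v + 1 := by
  refine (degree_le_card_of_forall_mem
    ((Finset.univ.filter fun e : G.E => v ∈ G.ends e).disjSum {v}) ?_).trans
    (Finset.card_disjSum _ _).le
  rintro (e | w) he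
  · exact Finset.inl_mem_disjSum.2 (Finset.mem_filter.2
      ⟨Finset.mem_univ e, base_mem_cone_ends_inl.1 he⟩)
  · exact Finset.inr_mem_disjSum.2 (Finset.mem_singleton.2 (base_mem_cone_ends_inr.1 he).symm)

lemma degree_cone_apex (G : Multigraph) :
    G.cone.degree G.apex ≤ Fintype.card G.V := by
  refine (degree_le_card_of_forall_mem ((∅ : Finset G.E).disjSum Finset.univ) ?_).trans
    ((Finset.card_disjSum _ _).trans (by simp)).le
  rintro (e | w) he
  · exact absurd he apex_notMem_cone_ends_inl
  · exact Finset.inr_mem_disjSum.2 (Finset.mem_univ w)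

lemma degree_le_maxDegree (G : Multigraph) (v : G.V) : G.degree v ≤ G.maxDegree :=
  Finset.le_sup (f := G.degree) (Finset.mem_univ v)

lemma maxDegree_cone_le (G : Multigraph) :
    G.cone.maxDegree ≤ max (G.maxDegree + 1) (Fintype.card G.V) := by
  refine Finset.sup_le fun v _ => ?_
  by_cases hv : v = G.apex
  · exact hv ▸ le_max_of_le_right G.degree_cone_apex
  · obtain ⟨v, rfl⟩ := exists_base_eq_of_ne_apex hv
    exact le_max_of_le_left
      ((G.degree_cone_base v).trans (Nat.add_le_add_right (G.degree_le_maxDegree v) 1))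

lemma sum_degree (G : Multigraph) : ∑ v, G.degree v = 2 * Fintype.card G.E := by
  have h : ∀ e : G.E, (Finset.univ.filter fun v : G.V => v ∈ G.ends e).card = 2 := by
    intro e
    have hd := G.loopless e
    rw [← Sym2.card_toFinset_of_not_isDiag _ hd]
    congr 1
    ext v
    simp
  calc ∑ v, G.degree v = ∑ e : G.E, (Finset.univ.filter fun v : G.V => v ∈ G.ends e).card :=
        Finset.sum_card_bipartiteAbove_eq_sum_card_bipartiteBelow fun v e => v ∈ G.ends e
    _ = 2 * Fintype.card G.E := by simp [h, mul_comm]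

lemma degree_le_of_map {H G : Multigraph} {f : H.V → G.V} {g : H.E → G.E}
    (hg : Function.Injective g) (hfg : ∀ e, G.ends (g e) = (H.ends e).map f) (v : H.V) :
    H.degree v ≤ G.degree (f v) := by
  refine Finset.card_le_card_of_injOn g (fun e he => ?_) hg.injOn
  have he' : v ∈ H.ends e := by simpa using he
  have : f v ∈ G.ends (g e) := by
    rw [hfg]
    exact Sym2.mem_map.2 ⟨v, he', rfl⟩
  simpa using this

lemma degree_apex_lt_card {H G : Multigraph} {f : H.V → G.cone.V} {g : H.E → G.cone.E}
    (hg : Function.Injective g) (hfg : ∀ e, G.cone.ends (g e) = (H.ends e).map f)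
    {a : H.V} (ha : f a = G.apex) : H.degree a + 1 ≤ Fintype.card H.V := by
  have hcard := Finset.card_erase_add_one (Finset.mem_univ a)
  rw [Finset.card_univ] at hcard
  rw [← hcard, Nat.add_le_add_iff_right]
  have key : ∀ e, a ∈ H.ends e → ∃ b, b ≠ a ∧ ∃ v : G.V, g e = Sum.inr v ∧
      f b = G.base v := by
    intro e he
    obtain ⟨b, hb⟩ := he
    have hba : b ≠ a := by
      rintro rfl
      exact H.loopless e (by rw [hb]; simp)
    refine ⟨b, hba, ?_⟩
    have h := hfg e
    rw [hb, Sym2.map_mk, ha] at h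
    rcases hge : g e with e' | v
    · rw [hge] at h
      exact absurd (h ▸ Sym2.mem_mk_left _ _) (apex_notMem_cone_ends_inl (e := e'))
    · rw [hge, cone_ends_inr] at h
      exact ⟨v, rfl, (Sym2.congr_right.1 h).symm⟩
  have : Nonempty H.V := ⟨a⟩
  choose! b hb hv using key
  refine Finset.card_le_card_of_injOn b (fun e he => ?_) ?_
  · have he' : a ∈ H.ends e := by simpa using he
    simpa using hb e he'
  · intro e he e' he' hee'
    obtain ⟨v, hv1, hv2⟩ := hv e (by simpa using he)
    obtain ⟨w, hw1, hw2⟩ := hv e' (by simpa using he')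
    rw [hee', hw2] at hv2
    obtain rfl : w = v := G.base_injective hv2
    exact hg (hv1.trans hw1.symm)

lemma isSubgraph_of_apex_notMem {H G : Multigraph} {f : H.V → G.cone.V} {g : H.E → G.cone.E}
    (hf : Function.Injective f) (hg : Function.Injective g)
    (hfg : ∀ e, G.cone.ends (g e) = (H.ends e).map f)
    (h : ∀ a, f a ≠ G.apex) : IsSubgraph H G := by
  have hf' : ∀ a, ∃ v : G.V, f a = G.base v := fun a => exists_base_eq_of_ne_apex (h a)
  have hg' : ∀ e, ∃ e' : G.E, g e = Sum.inl e' := by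
    intro e
    rcases hge : g e with e' | v
    · exact ⟨e', rfl⟩
    · have he := hfg e
      rw [hge, cone_ends_inr] at he
      have : G.apex ∈ (H.ends e).map f := by
        rw [← he]; exact Sym2.mem_mk_left _ _
      obtain ⟨c, -, hc⟩ := Sym2.mem_map.1 this
      exact absurd hc (h c)
  choose f' hf' using hf'
  choose g' hg' using hg'
  refine ⟨f', g', fun a b hab => hf (by rw [hf', hf', hab]),
    fun a b hab => hg (by rw [hg', hg', hab]), fun e => ?_⟩
  apply Sym2.map.injective G.base_injective
  rw [← cone_ends_inl, ← hg', hfg, Sym2.map_map]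
  congr 1
  exact funext hf'

lemma le_density {H G : Multigraph} (hHG : IsSubgraph H G) (hodd : Odd (Fintype.card H.V))
    (hcard : 3 ≤ Fintype.card H.V) :
    2 * (Fintype.card H.E : ℝ) / ((Fintype.card H.V : ℝ) - 1) ≤ G.density := by
  refine le_csSup ⟨2 * (Fintype.card G.E : ℝ), ?_⟩ (Or.inr ⟨H, hHG, hodd, hcard, rfl⟩)
  rintro q (rfl | ⟨K, ⟨_, g, _, hg, _⟩, -, hK, rfl⟩)
  · positivity
  · have hE : (Fintype.card K.E : ℝ) ≤ Fintype.card G.E := by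
      exact_mod_cast Fintype.card_le_of_injective g hg
    have hV : (3 : ℝ) ≤ Fintype.card K.V := by exact_mod_cast hK
    exact (div_le_self (by positivity) (by linarith)).trans (by linarith)

lemma two_mul_card_edges_le_of_apex_mem {H G : Multigraph} {k : ℕ} {f : H.V → G.cone.V}
    {g : H.E → G.cone.E} (hg : Function.Injective g)
    (hfg : ∀ e, G.cone.ends (g e) = (H.ends e).map f)
    (hk : G.cone.maxDegree + 1 ≤ k) {a : H.V} (ha : f a = G.apex) :
    2 * Fintype.card H.E ≤ k * (Fintype.card H.V - 1) := by
  obtain ⟨d, rfl⟩ : ∃ d, k = d + 1 := ⟨k - 1, by omega⟩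
  rw [← sum_degree, ← Finset.add_sum_erase _ _ (Finset.mem_univ a)]
  have h1 := degree_apex_lt_card hg hfg ha
  have h2 : ∑ v ∈ Finset.univ.erase a, H.degree v ≤ (Fintype.card H.V - 1) * d := by
    have := Finset.sum_le_card_nsmul (Finset.univ.erase a) H.degree d fun v _ =>
      ((degree_le_of_map hg hfg v).trans (degree_le_maxDegree _ _)).trans (by omega)
    simpa [Finset.card_erase_of_mem] using this
  rw [Nat.add_mul, one_mul, mul_comm d]
  omega

lemma density_cone_le {G : Multigraph} {k : ℕ} (hk : G.cone.maxDegree + 1 ≤ k)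
    (hρ : G.density ≤ k) : G.cone.density ≤ k := by
  refine csSup_le ⟨0, Or.inl rfl⟩ ?_
  rintro q (rfl | ⟨H, ⟨f, g, hf, hg, hfg⟩, hodd, hcard, rfl⟩)
  · positivity
  · by_cases h : ∃ a, f a = G.apex
    · obtain ⟨a, ha⟩ := h
      have hle := two_mul_card_edges_le_of_apex_mem hg hfg hk ha
      have hV : (3 : ℝ) ≤ Fintype.card H.V := by exact_mod_cast hcard
      rw [div_le_iff₀ (by linarith), ← Nat.cast_one, ← Nat.cast_sub (by omega)]
      exact_mod_cast hle
    · exact (le_density (isSubgraph_of_apex_notMem hf hg hfg (not_exists.1 h)) hodd hcard).trans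
        hρ

lemma exists_isProperEdgeColoring {G : Multigraph} {k : ℕ} (hk : G.chromaticIndex ≤ k) :
    ∃ φ : G.E → Fin k, G.IsProperEdgeColoring φ := by
  have hne : {k | ∃ φ : G.E → Fin k, G.IsProperEdgeColoring φ}.Nonempty :=
    ⟨Fintype.card G.E, Fintype.equivFin G.E, fun _ _ hef _ h =>
      hef ((Fintype.equivFin G.E).injective h)⟩
  obtain ⟨φ, hφ⟩ := Nat.sInf_mem hne
  exact ⟨fun e => Fin.castLE hk (φ e), fun e f hef hv h =>
    hφ e f hef hv (Fin.castLE_injective hk h)⟩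

/-- An edge coloring of the cone restricts to a total coloring of the base, each vertex taking the
color of the edge joining it to the apex. -/
lemma IsProperEdgeColoring.isProperTotalColoring_of_cone {G : Multigraph} {k : ℕ}
    {φ : G.cone.E → Fin k} (hφ : G.cone.IsProperEdgeColoring φ) :
    G.IsProperTotalColoring (fun v => φ (Sum.inr v)) (fun e => φ (Sum.inl e)) := by
  refine ⟨fun e f hef ⟨v, he, hf⟩ => ?_, fun u v ⟨e, he⟩ => ?_, fun v e hv => ?_⟩
  · exact hφ _ _ (fun h => hef (Sum.inl.inj h))
      ⟨G.base v, base_mem_cone_ends_inl.2 he, base_mem_cone_ends_inl.2 hf⟩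
  · refine hφ _ _ (fun h => G.loopless e ?_)
      ⟨G.apex, Sym2.mem_mk_left _ _, Sym2.mem_mk_left _ _⟩
    rw [he, Sum.inr.inj h]
    simp
  · exact hφ _ _ (fun h => by cases h)
      ⟨G.base v, Sym2.mem_mk_right _ _, base_mem_cone_ends_inl.2 hv⟩

lemma chromaticIndex_le_totalChromaticNumber {G : Multigraph} {k : ℕ} {cV : G.V → Fin k}
    {cE : G.E → Fin k} (h : G.IsProperTotalColoring cV cE) :
    G.chromaticIndex ≤ G.totalChromaticNumber := by
  obtain ⟨_, cE', h'⟩ := Nat.sInf_mem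
    (s := {k | ∃ (cV : G.V → Fin k) (cE : G.E → Fin k), G.IsProperTotalColoring cV cE})
    ⟨k, cV, cE, h⟩
  exact Nat.sInf_le ⟨cE', h'.1⟩

end Multigraph

/-- Assuming the Goldberg–Seymour statement, every multigraph `G`
with χ'(G) ≥ max{Δ(G)+2, |V(G)|+1} satisfies χ''(G) = χ'(G). -/
theorem total_eq_chromaticIndex_of_large_chromaticIndex
    (GS : ∀ H : Multigraph, H.maxDegree + 2 ≤ H.chromaticIndex →
      H.chromaticIndex = ⌈H.density⌉₊)
    (G : Multigraph)
    (hG : max (G.maxDegree + 2) (Fintype.card G.V + 1) ≤ G.chromaticIndex) :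
    G.totalChromaticNumber = G.chromaticIndex := by
  have hΔ : G.cone.maxDegree + 1 ≤ G.chromaticIndex := by
    have := G.maxDegree_cone_le
    omega
  have hρ : G.density ≤ G.chromaticIndex := by
    conv_rhs => rw [GS G (by omega)]
    exact Nat.le_ceil _
  have hcone : G.cone.chromaticIndex ≤ G.chromaticIndex := by
    by_contra! hlt
    have h := GS G.cone (by omega)
    have hceil := Nat.ceil_le.2 (density_cone_le hΔ hρ)
    omega
  obtain ⟨φ, hφ⟩ := exists_isProperEdgeColoring hcone
  have htotal := hφ.isProperTotalColoring_of_cone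
  exact le_antisymm (Nat.sInf_le ⟨_, _, htotal⟩) (chromaticIndex_le_totalChromaticNumber htotal)
end

section
/- Let G be a multigraph with χ'(G) = k, let φ be a proper edge k-coloring of G, and let H be a k-dense subgraph of G. Then H is strongly closed under φ: no color missing at some vertex of V(H) appears on a boundary edge of V(H), and no two distinct boundary edges of V(H) receive the same color. -/
open Multigraph

namespace Multigraph

variable {G : Multigraph} {k : ℕ} {φ : G.E → Fin k}

/-- Two edges of the same color that share an endpoint are equal. -/
theorem IsProperEdgeColoring.eq_of_mem (hφ : G.IsProperEdgeColoring φ) {e f : G.E} {v : G.V}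
    (he : v ∈ G.ends e) (hf : v ∈ G.ends f) (h : φ e = φ f) : e = f :=
  by_contra fun hne => hφ e f hne ⟨v, he, hf⟩ h

/-- The vertices covered by the edges of `S` that have color `c`. -/
def Sub.covered (S : G.Sub) (φ : G.E → Fin k) (c : Fin k) : Finset G.V :=
  (S.edges.filter fun e => φ e = c).biUnion fun e => (G.ends e).toFinset

theorem Sub.mem_covered {S : G.Sub} {c : Fin k} {v : G.V} :
    v ∈ S.covered φ c ↔ ∃ e ∈ S.edges, φ e = c ∧ v ∈ G.ends e := by
  simp [Sub.covered, and_assoc]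

theorem Sub.covered_subset (S : G.Sub) (φ : G.E → Fin k) (c : Fin k) :
    S.covered φ c ⊆ S.verts := fun v hv => by
  obtain ⟨e, he, -, hve⟩ := Sub.mem_covered.1 hv
  exact S.support e he v hve

/-- The edges of a color class of a proper coloring form a matching. -/
theorem Sub.card_covered (S : G.Sub) (hφ : G.IsProperEdgeColoring φ) (c : Fin k) :
    (S.covered φ c).card = 2 * (S.edges.filter fun e => φ e = c).card := by
  rw [Sub.covered, Finset.card_biUnion, Finset.sum_congr rfl fun e _ =>
    Sym2.card_toFinset_of_not_isDiag _ (G.loopless e), Finset.sum_const, smul_eq_mul, mul_comm]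
  intro e he f hf hne
  rw [Function.onFun, Finset.disjoint_left]
  intro v hve hvf
  simp only [Finset.coe_filter, Set.mem_ofPred_eq, Sym2.mem_toFinset] at he hf hve hvf
  exact hne (hφ.eq_of_mem hve hvf (he.2.trans hf.2.symm))

/-- In a `k`-dense subgraph every color class of a proper edge `k`-coloring is a
near-perfect matching. -/
theorem Sub.IsDense.card_covered {S : G.Sub} (hS : S.IsDense k)
    (hφ : G.IsProperEdgeColoring φ) (c : Fin k) :
    (S.covered φ c).card = S.verts.card - 1 := by
  obtain ⟨hodd, -, hcard⟩ := hS
  have hle : ∀ d ∈ Finset.univ, (S.covered φ d).card ≤ S.verts.card - 1 := fun d _ => by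
    have h₁ := Finset.card_le_card (S.covered_subset φ d)
    have h₂ := S.card_covered hφ d
    obtain ⟨m, hm⟩ := hodd
    omega
  have hsum : ∑ d, (S.covered φ d).card = ∑ _d : Fin k, (S.verts.card - 1) := by
    simp only [S.card_covered hφ, ← Finset.mul_sum, Finset.sum_const, Finset.card_univ,
      Fintype.card_fin, smul_eq_mul]
    rw [← hcard, Finset.card_eq_sum_card_fiberwise (f := φ) (t := Finset.univ) (by simp)]
  exact (Finset.sum_eq_sum_iff_of_le hle).1 hsum c (Finset.mem_univ c)

/-- In a `k`-dense subgraph at most one vertex is left uncovered by a given color. -/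
theorem Sub.IsDense.eq_of_notMem_covered {S : G.Sub} (hS : S.IsDense k)
    (hφ : G.IsProperEdgeColoring φ) {c : Fin k} {u v : G.V} (hu : u ∈ S.verts)
    (hv : v ∈ S.verts) (huc : u ∉ S.covered φ c) (hvc : v ∉ S.covered φ c) : u = v := by
  have hcard : (S.verts \ S.covered φ c).card ≤ 1 := by
    rw [Finset.card_sdiff_of_subset (S.covered_subset φ c), hS.card_covered hφ]
    omega
  exact Finset.card_le_one.1 hcard u (Finset.mem_sdiff.2 ⟨hu, huc⟩) v
    (Finset.mem_sdiff.2 ⟨hv, hvc⟩)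

/-- The inner end of a boundary edge is not covered by the color of that edge. -/
theorem Sub.notMem_covered_of_boundary (S : G.Sub) (hφ : G.IsProperEdgeColoring φ) {e : G.E}
    {a b : G.V} (he : G.ends e = s(a, b)) (hb : b ∉ S.verts) : a ∉ S.covered φ (φ e) := by
  intro ha
  obtain ⟨f, hf, hfe, haf⟩ := Sub.mem_covered.1 ha
  obtain rfl := hφ.eq_of_mem haf (he ▸ Sym2.mem_mk_left a b) hfe
  exact hb (S.support f hf b (he ▸ Sym2.mem_mk_right a b))

end Multigraph

/-- If χ'(G) = k, `φ` is a proper edge `k`-coloring of `G` and `H` is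
a `k`-dense subgraph of `G`, then `H` is strongly closed under `φ`: no color missing
at a vertex of `V(H)` appears on a boundary edge of `V(H)`, and distinct boundary
edges of `V(H)` receive distinct colors. -/
theorem dense_subgraph_stronglyClosed
    (G : Multigraph) (k : ℕ) (hk : G.chromaticIndex = k)
    (φ : G.E → Fin k) (hφ : G.IsProperEdgeColoring φ)
    (S : G.Sub) (hS : S.IsDense k) :
    (∀ v ∈ S.verts, ∀ c ∈ G.missing φ v,
      ∀ e : G.E, G.IsBoundaryEdge (↑S.verts : Set G.V) e → φ e ≠ c) ∧
    (∀ e f : G.E, G.IsBoundaryEdge (↑S.verts : Set G.V) e →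
      G.IsBoundaryEdge (↑S.verts : Set G.V) f → e ≠ f → φ e ≠ φ f) := by
  refine ⟨?_, ?_⟩
  · rintro v hv c hc e ⟨a, b, he, ha, hb⟩ rfl
    have hae : a ∈ G.ends e := he ▸ Sym2.mem_mk_left a b
    have hvc : v ∉ S.covered φ (φ e) := fun h => by
      obtain ⟨f, -, hf, hvf⟩ := Sub.mem_covered.1 h
      exact hc f hvf hf
    obtain rfl := hS.eq_of_notMem_covered hφ hv ha hvc (S.notMem_covered_of_boundary hφ he hb)
    exact hc e hae rfl
  · rintro e f ⟨a, b, he, ha, hb⟩ ⟨a', b', hf, ha', hb'⟩ hne h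
    have haa' : a = a' := hS.eq_of_notMem_covered hφ ha ha'
      (S.notMem_covered_of_boundary hφ he hb) (h ▸ S.notMem_covered_of_boundary hφ hf hb')
    subst haa'
    exact hne (hφ.eq_of_mem (he ▸ Sym2.mem_mk_left a b) (hf ▸ Sym2.mem_mk_left a b') h)
end

section
/- Let G be a multigraph with χ'(G) = k ≥ Δ(G)+1, and let H₁ and H₂ be two distinct maximal k-dense subgraphs of G. Then V(H₁) ∩ V(H₂) = ∅. -/
open Multigraph

namespace Multigraph

variable {G : Multigraph}

/-- The edges of `G` with both ends in `U`. -/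
def edgesIn (U : Finset G.V) : Finset G.E :=
  Finset.univ.filter fun e => (G.ends e).toFinset ⊆ U

lemma mem_edgesIn {U : Finset G.V} {e : G.E} :
    e ∈ edgesIn U ↔ (G.ends e).toFinset ⊆ U := by
  simp [edgesIn]

lemma Sub.edges_subset_edgesIn (S : G.Sub) : S.edges ⊆ edgesIn S.verts := fun e he =>
  mem_edgesIn.2 fun v hv => S.support e he v (Sym2.mem_toFinset.1 hv)

lemma card_toFinset_ends (e : G.E) : (G.ends e).toFinset.card = 2 :=
  Sym2.card_toFinset_of_not_isDiag _ (G.loopless e)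

lemma IsProperEdgeColoring.two_mul_card_colorClass_le {k : ℕ} {φ : G.E → Fin k}
    (hφ : G.IsProperEdgeColoring φ) (U : Finset G.V) (c : Fin k) :
    2 * ((edgesIn U).filter fun e => φ e = c).card ≤ U.card := by
  have hdisj : Set.PairwiseDisjoint (↑((edgesIn U).filter fun e => φ e = c))
      (fun e => (G.ends e).toFinset) := by
    intro e he f hf hef
    rw [Finset.mem_coe, Finset.mem_filter] at he hf
    refine Finset.disjoint_left.2 fun v hv hv' => ?_
    exact hφ e f hef ⟨v, Sym2.mem_toFinset.1 hv, Sym2.mem_toFinset.1 hv'⟩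
      (he.2.trans hf.2.symm)
  calc 2 * ((edgesIn U).filter fun e => φ e = c).card
      = (((edgesIn U).filter fun e => φ e = c).biUnion
          fun e => (G.ends e).toFinset).card := by
        rw [Finset.card_biUnion hdisj, Finset.sum_congr rfl fun e _ => card_toFinset_ends e,
          Finset.sum_const, smul_eq_mul, mul_comm]
    _ ≤ U.card := Finset.card_le_card <| Finset.biUnion_subset.2 fun e he =>
        mem_edgesIn.1 (Finset.mem_filter.1 he).1

lemma IsProperEdgeColoring.two_mul_card_edgesIn_le {k : ℕ} {φ : G.E → Fin k}
    (hφ : G.IsProperEdgeColoring φ) {U : Finset G.V} (hU : Odd U.card) :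
    2 * (edgesIn U).card ≤ k * (U.card - 1) := by
  rw [Finset.card_eq_sum_card_fiberwise (f := φ) (t := Finset.univ) (fun _ _ => by simp),
    Finset.mul_sum]
  calc ∑ c, 2 * ((edgesIn U).filter fun e => φ e = c).card
      ≤ ∑ _c : Fin k, (U.card - 1) := Finset.sum_le_sum fun c _ => by
        have h := hφ.two_mul_card_colorClass_le U c
        obtain ⟨m, hm⟩ := hU
        omega
    _ = k * (U.card - 1) := by simp

lemma IsProperEdgeColoring.edges_eq_edgesIn {k : ℕ} {φ : G.E → Fin k}
    (hφ : G.IsProperEdgeColoring φ) {S : G.Sub} (hS : S.IsDense k) :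
    S.edges = edgesIn S.verts := by
  refine Finset.eq_of_subset_of_card_le S.edges_subset_edgesIn ?_
  have := hφ.two_mul_card_edgesIn_le hS.1
  have := hS.2.2
  omega

lemma card_edgesIn_add_le_union_inter (U W : Finset G.V) :
    (edgesIn U).card + (edgesIn W).card ≤
      (edgesIn (U ∪ W)).card + (edgesIn (U ∩ W)).card := by
  rw [← Finset.card_union_add_card_inter]
  refine add_le_add (Finset.card_le_card ?_) (Finset.card_le_card ?_)
  · intro e he
    rw [Finset.mem_union, mem_edgesIn, mem_edgesIn] at he
    exact mem_edgesIn.2 <| he.elim (fun h => h.trans Finset.subset_union_left)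
      fun h => h.trans Finset.subset_union_right
  · intro e he
    rw [Finset.mem_inter, mem_edgesIn, mem_edgesIn] at he
    exact mem_edgesIn.2 (Finset.subset_inter he.1 he.2)

lemma sum_degree_eq_sum_card_inter (I : Finset G.V) :
    ∑ v ∈ I, G.degree v = ∑ e : G.E, ((G.ends e).toFinset ∩ I).card := by
  simp only [degree, Finset.card_filter]
  rw [Finset.sum_comm]
  refine Finset.sum_congr rfl fun e _ => ?_
  rw [← Finset.card_filter]
  congr 1
  ext v
  simp [and_comm]

lemma card_edgesIn_add_le_sdiff_add_sum_degree (U W : Finset G.V) :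
    (edgesIn U).card + (edgesIn W).card ≤
      (edgesIn (U \ W)).card + (edgesIn (W \ U)).card + ∑ v ∈ U ∩ W, G.degree v := by
  rw [sum_degree_eq_sum_card_inter]
  simp only [edgesIn, Finset.card_filter, ← Finset.sum_add_distrib]
  refine Finset.sum_le_sum fun e _ => ?_
  have key : ∀ A B : Finset G.V, (G.ends e).toFinset ⊆ A → ¬ (G.ends e).toFinset ⊆ A \ B →
      1 ≤ ((G.ends e).toFinset ∩ (A ∩ B)).card := by
    intro A B hA hAB
    obtain ⟨v, hv, hv'⟩ := Finset.not_subset.1 hAB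
    refine Finset.card_pos.2 ⟨v, ?_⟩
    have := hA hv
    simp_all
  by_cases hU : (G.ends e).toFinset ⊆ U <;> by_cases hW : (G.ends e).toFinset ⊆ W
  · rw [Finset.inter_eq_left.2 (Finset.subset_inter hU hW), card_toFinset_ends]
    simp only [hU, hW, if_true]
    omega
  · have := key U W hU
    simp only [hU, hW, if_true, if_false]
    split_ifs <;> grind
  · have := key W U hW
    rw [Finset.inter_comm W U] at this
    simp only [hU, hW, if_true, if_false]
    split_ifs <;> grind
  · simp [hU, hW]

lemma exists_isProperEdgeColoring_of_chromaticIndex_pos (h : 0 < G.chromaticIndex) :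
    ∃ φ : G.E → Fin G.chromaticIndex, G.IsProperEdgeColoring φ :=
  Nat.sInf_mem (Nat.nonempty_of_pos_sInf h)

/-- The subgraph of `G` induced by a set of vertices. -/
def Sub.induce (U : Finset G.V) : G.Sub where
  verts := U
  edges := edgesIn U
  support _ he _ hv := mem_edgesIn.1 he (Sym2.mem_toFinset.2 hv)

lemma IsProperEdgeColoring.isDense_induce_union {k : ℕ} {φ : G.E → Fin k}
    (hφ : G.IsProperEdgeColoring φ) {S T : G.Sub} (hS : S.IsDense k) (hT : T.IsDense k)
    (hodd : Odd (S.verts ∩ T.verts).card) :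
    (Sub.induce (S.verts ∪ T.verts)).IsDense k := by
  have hcard := Finset.card_union_add_card_inter S.verts T.verts
  have hSU := Finset.card_le_card (Finset.subset_union_left (s₁ := S.verts) (s₂ := T.verts))
  have hU : Odd (S.verts ∪ T.verts).card := by
    have hS1 := hS.1
    have hT1 := hT.1
    rw [Nat.odd_iff] at *
    omega
  refine ⟨hU, hS.2.1.trans hSU, le_antisymm (hφ.two_mul_card_edgesIn_le hU) ?_⟩
  have hI := hφ.two_mul_card_edgesIn_le hodd
  have hadd := card_edgesIn_add_le_union_inter S.verts T.verts
  have hS2 := hS.2.2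
  have hT2 := hT.2.2
  rw [hφ.edges_eq_edgesIn hS] at hS2
  rw [hφ.edges_eq_edgesIn hT] at hT2
  have hsplit : k * ((S.verts ∪ T.verts).card - 1) + k * ((S.verts ∩ T.verts).card - 1) =
      k * (S.verts.card - 1) + k * (T.verts.card - 1) := by
    have := hS.2.1
    have := hT.2.1
    have := hodd.pos
    rw [← mul_add, ← mul_add]
    congr 1
    omega
  change _ ≤ 2 * (edgesIn (S.verts ∪ T.verts)).card
  change k * ((S.verts ∪ T.verts).card - 1) ≤ _
  omega

lemma IsProperEdgeColoring.not_even_card_inter {k : ℕ} {φ : G.E → Fin k}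
    (hφ : G.IsProperEdgeColoring φ) (hk : G.maxDegree + 1 ≤ k) {S T : G.Sub}
    (hS : S.IsDense k) (hT : T.IsDense k) (hne : (S.verts ∩ T.verts).Nonempty) :
    ¬ Even (S.verts ∩ T.verts).card := by
  intro heven
  have hST := Finset.card_sdiff_add_card_inter S.verts T.verts
  have hTS := Finset.card_sdiff_add_card_inter T.verts S.verts
  rw [Finset.inter_comm T.verts] at hTS
  have hS1 := hS.1
  have hT1 := hT.1
  have hA : Odd (S.verts \ T.verts).card := by rw [Nat.odd_iff, Nat.even_iff] at *; omega
  have hB : Odd (T.verts \ S.verts).card := by rw [Nat.odd_iff, Nat.even_iff] at *; omega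
  have hA2 := hφ.two_mul_card_edgesIn_le hA
  have hB2 := hφ.two_mul_card_edgesIn_le hB
  have hS2 := hS.2.2
  have hT2 := hT.2.2
  rw [hφ.edges_eq_edgesIn hS] at hS2
  rw [hφ.edges_eq_edgesIn hT] at hT2
  have hadd := card_edgesIn_add_le_sdiff_add_sum_degree S.verts T.verts
  have hdeg : ∑ v ∈ S.verts ∩ T.verts, G.degree v < (S.verts ∩ T.verts).card * k := by
    rw [← smul_eq_mul, ← Finset.sum_const]
    exact Finset.sum_lt_sum_of_nonempty hne fun v _ =>
      (Nat.lt_succ_of_le (Finset.le_sup (f := G.degree) (Finset.mem_univ v))).trans_le hk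
  have hsplit : k * (S.verts.card - 1) + k * (T.verts.card - 1) =
      k * ((S.verts \ T.verts).card - 1) + k * ((T.verts \ S.verts).card - 1) +
        2 * ((S.verts ∩ T.verts).card * k) := by
    have := hA.pos
    have := hB.pos
    rw [mul_comm _ k, mul_left_comm, ← mul_add, ← mul_add, ← mul_add]
    congr 1
    omega
  omega

end Multigraph

/-- If χ'(G) = k ≥ Δ(G)+1 and `H₁`, `H₂` are distinct maximal
`k`-dense subgraphs of `G`, then `V(H₁) ∩ V(H₂) = ∅`. -/
theorem maximal_dense_subgraphs_disjoint
    (G : Multigraph) (k : ℕ) (hchi : G.chromaticIndex = k)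
    (hk : G.maxDegree + 1 ≤ k)
    (H₁ H₂ : G.Sub) (h₁ : H₁.MaximalDense k) (h₂ : H₂.MaximalDense k)
    (hne : H₁ ≠ H₂) :
    H₁.verts ∩ H₂.verts = ∅ := by
  subst hchi
  obtain ⟨φ, hφ⟩ := exists_isProperEdgeColoring_of_chromaticIndex_pos
    (Nat.succ_pos _ |>.trans_le hk)
  by_contra hinter
  have hodd := Nat.not_even_iff_odd.1 <|
    hφ.not_even_card_inter hk h₁.1 h₂.1 (Finset.nonempty_iff_ne_empty.2 hinter)
  have hU := hφ.isDense_induce_union h₁.1 h₂.1 hodd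
  have eq_induce : ∀ S : G.Sub, S.MaximalDense G.chromaticIndex →
      S.verts ⊆ H₁.verts ∪ H₂.verts → S = Sub.induce (H₁.verts ∪ H₂.verts) := by
    intro S hS hsub
    obtain ⟨hV, hE⟩ := hS.2 _ hU hsub fun e he =>
      mem_edgesIn.2 ((mem_edgesIn.1 (S.edges_subset_edgesIn he)).trans hsub)
    cases S
    simp_all [Sub.induce]
  exact hne <| (eq_induce H₁ h₁ Finset.subset_union_left).trans
    (eq_induce H₂ h₂ Finset.subset_union_right).symm
end

section
/- Let H be a multigraph, let e ∈ E(H) with endpoints a and b, let k be a positive integer, and let φ be a proper edge (k−1)-coloring of H−e under which V(H) is elementary. Then k−1 ≥ 2 + Σ_{v∈V(H)} (k−1−d_H(v)), where d_H(v) is the degree of v in H. In particular, if d_H(v) ≤ Δ for all v, then k−1 ≥ (k−1−Δ)|V(H)| + 2. -/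
open Multigraph

namespace Multigraph

/-- At most `degree v` of the `k` colors are present at `v`. -/
theorem le_ncard_missing_add_degree (G : Multigraph) {k : ℕ} (φ : G.E → Fin k) (v : G.V) :
    k ≤ (G.missing φ v).ncard + G.degree v := by
  classical
  have hcompl : (G.missing φ v)ᶜ =
      ((Finset.univ.filter fun f : G.E => v ∈ G.ends f).image φ : Finset (Fin k)) := by
    ext c
    simp [missing]
  have hle : ((G.missing φ v)ᶜ).ncard ≤ G.degree v := by
    rw [hcompl, Set.ncard_coe_finset]
    exact Finset.card_image_le
  have hadd := Set.ncard_add_ncard_compl (G.missing φ v)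
  rw [Nat.card_fin] at hadd
  omega

/-- Deleting an edge lowers the degree of exactly its ends by one. -/
theorem degree_deleteEdge_add (G : Multigraph) (e : G.E) (v : G.V) :
    (G.deleteEdge e).degree v + (if v ∈ G.ends e then 1 else 0) = G.degree v := by
  have hmap : (G.deleteEdge e).degree v =
      ((Finset.univ.filter fun f : G.E => v ∈ G.ends f).erase e).card := by
    refine Finset.card_bij (fun f _ => f.1) (fun f hf => ?_)
      (fun f _ g _ hfg => Subtype.ext hfg) (fun f hf => ?_)
    · have hv : v ∈ G.ends f.1 := ((@Finset.mem_filter _ _ (_) _ _).mp hf).2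
      simp [hv, f.2]
    · simp only [Finset.mem_erase, Finset.mem_filter, Finset.mem_univ, true_and] at hf
      exact ⟨⟨f, hf.1⟩, (@Finset.mem_filter _ _ (_) _ _).mpr
        ⟨@Finset.mem_univ _ (G.deleteEdge e).fintypeE _, hf.2⟩, rfl⟩
  rw [hmap]
  split_ifs with hv
  · exact Finset.card_erase_add_one (by simpa using hv)
  · rw [Finset.erase_eq_of_notMem (by simpa using hv)]
    rfl

/-- If the whole vertex set is elementary, the missing color sets have total size at most `k`. -/
theorem Elementary.sum_ncard_missing_le {G : Multigraph} {k : ℕ} {φ : G.E → Fin k}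
    (h : G.Elementary φ Set.univ) : ∑ v : G.V, (G.missing φ v).ncard ≤ k := by
  classical
  have hdisj : Set.PairwiseDisjoint ((Finset.univ : Finset G.V) : Set G.V)
      fun v => (G.missing φ v).toFinset := fun u _ v _ huv =>
    Set.disjoint_toFinset.mpr (h u trivial v trivial huv)
  calc ∑ v : G.V, (G.missing φ v).ncard = ∑ v : G.V, (G.missing φ v).toFinset.card :=
        Finset.sum_congr rfl fun v _ => Set.ncard_eq_toFinset_card' _
    _ = (Finset.univ.biUnion fun v => (G.missing φ v).toFinset).card :=
        (Finset.card_biUnion hdisj).symm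
    _ ≤ k := by
        simpa using Finset.card_le_univ (Finset.univ.biUnion fun v => (G.missing φ v).toFinset)

/-- Every edge has exactly two ends. -/
theorem sum_mem_ends (G : Multigraph) (e : G.E) :
    ∑ v : G.V, (if v ∈ G.ends e then 1 else 0) = 2 := by
  rw [← Finset.card_filter, ← Sym2.card_toFinset_of_not_isDiag _ (G.loopless e)]
  congr 1
  ext v
  simp

end Multigraph

/-- If `e` is an edge of `H` with endpoints `a`, `b`, `k ≥ 1`, and
`φ` is a proper edge `(k−1)`-coloring of `H−e` under which `V(H)` is elementary,
then `k−1 ≥ 2 + Σ_{v∈V(H)} (k−1−d_H(v))`; in particular, if `d_H(v) ≤ Δ` for all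
`v`, then `k−1 ≥ (k−1−Δ)|V(H)| + 2`. -/
theorem elementary_counting
    (H : Multigraph) (e : H.E) (a b : H.V) (he : H.ends e = s(a, b))
    (k : ℕ) (hk : 0 < k)
    (φ : (H.deleteEdge e).E → Fin (k - 1))
    (hφ : (H.deleteEdge e).IsProperEdgeColoring φ)
    (helem : (H.deleteEdge e).Elementary φ Set.univ) :
    (2 + ∑ v : H.V, ((k : ℤ) - 1 - (H.degree v : ℤ)) ≤ (k : ℤ) - 1) ∧
    (∀ Δ : ℕ, (∀ v : H.V, H.degree v ≤ Δ) →
      ((k : ℤ) - 1 - (Δ : ℤ)) * (Fintype.card H.V : ℤ) + 2 ≤ (k : ℤ) - 1) := by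
  have hmain : 2 + ∑ v : H.V, ((k : ℤ) - 1 - (H.degree v : ℤ)) ≤ (k : ℤ) - 1 := by
    have hvertex : ∀ v : H.V, (k : ℤ) - 1 - (H.degree v : ℤ) +
        ((if v ∈ H.ends e then 1 else 0 : ℕ) : ℤ) ≤
        (((H.deleteEdge e).missing φ v).ncard : ℤ) := fun v => by
      have h₁ := le_ncard_missing_add_degree (H.deleteEdge e) φ v
      have h₂ := degree_deleteEdge_add H e v
      omega
    have hsum := Finset.sum_le_sum fun v (_ : v ∈ Finset.univ) => hvertex v
    rw [Finset.sum_add_distrib, ← Nat.cast_sum, ← Nat.cast_sum, sum_mem_ends] at hsum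
    have hcolors : ∑ v : H.V, ((H.deleteEdge e).missing φ v).ncard ≤ k - 1 :=
      helem.sum_ncard_missing_le
    omega
  refine ⟨hmain, fun Δ hΔ => ?_⟩
  have hle : ∑ _v : H.V, ((k : ℤ) - 1 - (Δ : ℤ)) ≤
      ∑ v : H.V, ((k : ℤ) - 1 - (H.degree v : ℤ)) :=
    Finset.sum_le_sum fun v _ => by have := hΔ v; omega
  rw [Finset.sum_const, Finset.card_univ, nsmul_eq_mul, mul_comm] at hle
  linarith
end
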